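/- Let f : ℍ → ℂ be a cusp form of weight 2 for Γ₁(N) and for x in (ℤ/Nℤ)² primitive let g_x ∈ SL₂(ℤ) be a matrix with bottom row congruent to x mod N. Then the Manin symbols ξ_f(x) = −i ∫_{g_x·0}^{g_x·∞} f(z) dz satisfy ξ_f(xσ) = −ξ_f(x) and ξ_f(x) + ξ_f(xτ) + ξ_f(xτ²) = 0, where σ = [[0,−1],[1,0]] and τ = [[0,−1],[1,−1]]. -/

import Mathlib

open UpperHalfPlane MatrixGroups

/-- The weight-2 slash of `f : ℍ → ℂ` by `g ∈ SL₂(ℤ)`, viewed as a function of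
the complex variable `w` (extended by `0` off the upper half-plane):
`(f ∣[2] g)(w) = f(g·w)/(cw+d)²`. -/
noncomputable def vslash (f : ℍ → ℂ) (g : SL(2, ℤ)) (w : ℂ) : ℂ :=
  if h : 0 < w.im then
    f (g • (UpperHalfPlane.mk w h)) /
      (((g : Matrix (Fin 2) (Fin 2) ℤ) 1 0 : ℂ) * w +
        ((g : Matrix (Fin 2) (Fin 2) ℤ) 1 1 : ℂ)) ^ 2
  else 0

/-- The Manin symbol `ξ_f(x) = -i ∫_{g_x 0}^{g_x ∞} f(z) dz`, computed by the
substitution `z = g_x · (is)`, `s ∈ (0,∞)`: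
`ξ_f(x) = ∫_0^∞ (f ∣[2] g_x)(is) ds`. -/
noncomputable def maninSymbol (f : ℍ → ℂ) (g : SL(2, ℤ)) : ℂ :=
  ∫ s in Set.Ioi (0 : ℝ), vslash f g (Complex.I * s)

section Aux

open Filter Topology MeasureTheory

lemma vslash_coe (f : ℍ → ℂ) (g : SL(2, ℤ)) (z : ℍ) :
    vslash f g (z : ℂ) = (SlashAction.map (2 : ℤ) g f) z := by
  have hz : 0 < (z : ℂ).im := z.im_pos
  rw [vslash, dif_pos hz, ModularForm.SL_slash_apply]
  have : UpperHalfPlane.mk (z : ℂ) hz = z := rfl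
  rw [this, div_eq_mul_inv, zpow_neg]
  congr 2

lemma vslash_eq (f : ℍ → ℂ) (g : SL(2, ℤ)) (w : ℂ) (hw : 0 < w.im) :
    vslash f g w = (SlashAction.map (2 : ℤ) g f) ⟨w, hw⟩ := vslash_coe f g ⟨w, hw⟩

lemma denom_ne (h : SL(2, ℤ)) (w : ℂ) (hw : 0 < w.im) :
    ((h 1 0 : ℤ) : ℂ) * w + ((h 1 1 : ℤ) : ℂ) ≠ 0 := by
  have := UpperHalfPlane.denom_ne_zero (h : GL (Fin 2) ℝ) ⟨w, hw⟩
  simpa [UpperHalfPlane.denom] using this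

lemma moeb_im (h : SL(2, ℤ)) (w : ℂ) (hw : 0 < w.im) :
    0 < ((((h 0 0 : ℤ) : ℂ) * w + ((h 0 1 : ℤ) : ℂ)) /
      (((h 1 0 : ℤ) : ℂ) * w + ((h 1 1 : ℤ) : ℂ))).im := by
  have := (h • (⟨w, hw⟩ : ℍ)).im_pos
  rw [← UpperHalfPlane.coe_im, UpperHalfPlane.coe_specialLinearGroup_apply] at this
  simpa using this

lemma vslash_mul (f : ℍ → ℂ) (g h : SL(2, ℤ)) (w : ℂ) (hw : 0 < w.im) :
    vslash f (g * h) w = vslash f g ((((h 0 0 : ℤ) : ℂ) * w + ((h 0 1 : ℤ) : ℂ)) /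
      (((h 1 0 : ℤ) : ℂ) * w + ((h 1 1 : ℤ) : ℂ))) /
      (((h 1 0 : ℤ) : ℂ) * w + ((h 1 1 : ℤ) : ℂ)) ^ 2 := by
  rw [vslash_eq f (g * h) w hw, SlashAction.slash_mul, ModularForm.SL_slash_apply]
  rw [← vslash_coe, UpperHalfPlane.coe_specialLinearGroup_apply, zpow_neg, ← div_eq_mul_inv]
  simp [UpperHalfPlane.denom]

lemma vslash_congr (N : ℕ) [NeZero N] (f : CuspForm (CongruenceSubgroup.Gamma1 N) 2)
    (g g' : SL(2, ℤ))
    (h : ∀ j : Fin 2, ((g' : Matrix (Fin 2) (Fin 2) ℤ) 1 j : ZMod N) =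
      ((g : Matrix (Fin 2) (Fin 2) ℤ) 1 j : ZMod N)) :
    vslash f g' = vslash f g := by
  have hmem : g' * g⁻¹ ∈ CongruenceSubgroup.Gamma1 N := by
    have d1 := congrArg (Int.cast : ℤ → ZMod N) g.det_coe
    have d2 := congrArg (Int.cast : ℤ → ZMod N) g'.det_coe
    rw [Matrix.det_fin_two] at d1 d2
    have h0 := h 0
    have h1 := h 1
    push_cast at d1 d2
    rw [CongruenceSubgroup.Gamma1_mem]
    simp only [Matrix.SpecialLinearGroup.coe_mul, Matrix.SpecialLinearGroup.coe_inv,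
      Matrix.adjugate_fin_two, Matrix.mul_apply, Fin.sum_univ_two]
    simp
    rw [h0, h1] at *
    refine ⟨?_, ?_, ?_⟩
    · linear_combination d2
    · linear_combination d1
    · ring
  have e : g' = (g' * g⁻¹) * g := by group
  funext w
  by_cases hw : 0 < w.im
  · rw [vslash_eq _ _ _ hw, vslash_eq _ _ _ hw, e, SlashAction.slash_mul]
    have := SlashInvariantForm.slash_action_eqn f (g' * g⁻¹ : SL(2, ℤ))
      (Subgroup.mem_map_of_mem _ hmem)
    rw [ModularForm.SL_slash f]
    erw [this]
  · simp [vslash, hw]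

lemma vslash_diff (N : ℕ) [NeZero N] (f : CuspForm (CongruenceSubgroup.Gamma1 N) 2)
    (g : SL(2, ℤ)) (w : ℂ) (hw : 0 < w.im) : DifferentiableAt ℂ (vslash f g) w := by
  have h1 := CuspFormClass.holo (CuspForm.translate f (g : GL (Fin 2) ℝ))
  have h2 := UpperHalfPlane.mdifferentiableAt_iff.mp (h1 ⟨w, hw⟩)
  refine h2.congr_of_eventuallyEq ?_
  filter_upwards [(isOpen_lt continuous_const Complex.continuous_im).mem_nhds hw] with v hv
  rw [vslash_eq _ _ _ hv, Function.comp, UpperHalfPlane.ofComplex_apply_of_im_pos hv]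
  rfl

open Pointwise in
lemma vslash_decay (N : ℕ) [NeZero N] (f : CuspForm (CongruenceSubgroup.Gamma1 N) 2)
    (g : SL(2, ℤ)) : ∃ C A : ℝ, 0 < C ∧ 0 < A ∧ ∀ w : ℂ, A ≤ w.im →
      ‖vslash f g w‖ ≤ C / w.im ^ 2 := by
  have : (ConjAct.toConjAct (g : GL (Fin 2) ℝ)⁻¹ •
      ((CongruenceSubgroup.Gamma1 N : Subgroup SL(2, ℤ)) :
        Subgroup (GL (Fin 2) ℝ))).IsArithmetic := by
    have h := Subgroup.IsArithmetic.conj ((CongruenceSubgroup.Gamma1 N : Subgroup SL(2, ℤ)) :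
        Subgroup (GL (Fin 2) ℝ)) (Matrix.SpecialLinearGroup.mapGL ℚ g⁻¹ : GL (Fin 2) ℚ)
    have e : (Matrix.SpecialLinearGroup.mapGL ℚ g⁻¹ : GL (Fin 2) ℚ).map (Rat.castHom ℝ) =
        (g : GL (Fin 2) ℝ)⁻¹ := by
      rw [map_inv, map_inv]
      congr 1
      ext i j
      simp
    rwa [e] at h
  obtain ⟨c, hc, hO⟩ := CuspFormClass.exp_decay_atImInfty' (CuspForm.translate f (g : GL (Fin 2) ℝ))
  have h2 : (fun τ : ℍ ↦ Real.exp (-c * τ.im)) =O[atImInfty] fun τ : ℍ ↦ (τ.im) ^ (-2 : ℝ) :=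
    ((isLittleO_exp_neg_mul_rpow_atTop hc (-2)).isBigO).comp_tendsto tendsto_comap
  obtain ⟨C, hC, hb⟩ := (hO.trans h2).exists_pos
  rw [Asymptotics.IsBigOWith, atImInfty, eventually_comap, eventually_atTop] at hb
  obtain ⟨A, hA⟩ := hb
  refine ⟨C, max A 1, hC, by positivity, fun w hw => ?_⟩
  have hw0 : 0 < w.im := lt_of_lt_of_le (by positivity) hw
  have := hA w.im ((le_max_left _ _).trans hw) ⟨w, hw0⟩ rfl
  rw [vslash_eq _ _ _ hw0]
  refine this.trans (le_of_eq ?_)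
  have e : (⟨w, hw0⟩ : ℍ).im = w.im := rfl
  rw [e, Real.norm_of_nonneg (by positivity), Real.rpow_neg hw0.le, div_eq_mul_inv]
  norm_num

lemma exists_prim (F : ℂ → ℂ) (hF : ∀ w : ℂ, 0 < w.im → DifferentiableAt ℂ F w) :
    ∃ G : ℂ → ℂ, ∀ w : ℂ, 0 < w.im → HasDerivAt G (F w) w := by
  have key : ∀ u ∈ Metric.ball (0 : ℂ) 1, u ≠ 1 ∧ 0 < (Complex.I * (1 + u) / (1 - u)).im := by
    intro u hu
    have hu1 : ‖u‖ < 1 := by simpa using hu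
    have hne : u ≠ 1 := by rintro rfl; simp at hu1
    refine ⟨hne, ?_⟩
    have h1 : 0 < Complex.normSq (1 - u) := Complex.normSq_pos.2 (sub_ne_zero.2 hne.symm)
    have h2 : Complex.normSq u < 1 := by
      rw [Complex.normSq_eq_norm_sq]; nlinarith [norm_nonneg u]
    have : (Complex.I * (1 + u) / (1 - u)).im = (1 - Complex.normSq u) / Complex.normSq (1 - u) := by
      rw [Complex.div_im]
      field_simp
      simp [Complex.normSq_apply]
      ring
    rw [this]
    exact div_pos (by linarith) h1
  have hd : DifferentiableOn ℂ (fun u => F (Complex.I * (1 + u) / (1 - u)) * (2 * Complex.I / (1 - u) ^ 2))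
      (Metric.ball 0 1) := by
    intro u hu
    obtain ⟨hne, him⟩ := key u hu
    have hne' : (1 - u) ≠ 0 := sub_ne_zero.2 hne.symm
    apply DifferentiableAt.differentiableWithinAt
    have h1 : DifferentiableAt ℂ (fun u => Complex.I * (1 + u) / (1 - u)) u := by
      fun_prop (disch := assumption)
    have h2 : DifferentiableAt ℂ (fun u : ℂ => (2 * Complex.I / (1 - u) ^ 2)) u := by
      fun_prop (disch := simpa using hne')
    exact (DifferentiableAt.comp u (hF _ him) h1).mul h2
  obtain ⟨P, hP⟩ := hd.isExactOn_ball
  refine ⟨fun w => P ((w - Complex.I) / (w + Complex.I)), fun w hw => ?_⟩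
  have hwI : w + Complex.I ≠ 0 := by
    intro h; have := congrArg Complex.im h; simp at this; linarith
  have hball : (w - Complex.I) / (w + Complex.I) ∈ Metric.ball (0 : ℂ) 1 := by
    simp only [Metric.mem_ball, dist_zero_right, norm_div]
    rw [div_lt_one (norm_pos_iff.2 hwI)]
    rw [← sq_lt_sq₀ (norm_nonneg _) (norm_nonneg _), ← Complex.normSq_eq_norm_sq,
      ← Complex.normSq_eq_norm_sq]
    simp [Complex.normSq_apply]
    nlinarith
  have hm : HasDerivAt (fun w : ℂ => (w - Complex.I) / (w + Complex.I)) (2 * Complex.I / (w + Complex.I) ^ 2) w := by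
    have := ((hasDerivAt_id w).sub_const Complex.I).div ((hasDerivAt_id w).add_const Complex.I) hwI
    refine this.congr_deriv ?_
    simp only [id]; ring
  have := (hP _ hball).comp w hm
  refine this.congr_deriv ?_
  have e1 : 1 - (w - Complex.I) / (w + Complex.I) = 2 * Complex.I / (w + Complex.I) := by field_simp; ring
  have e2 : Complex.I * (1 + (w - Complex.I) / (w + Complex.I)) / (1 - (w - Complex.I) / (w + Complex.I)) = w := by
    rw [e1]; field_simp; ring
  simp only []
  rw [e2, e1]
  field_simp

lemma im_I_mul (s : ℝ) : (Complex.I * (s : ℂ)).im = s := by simp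

lemma vslash_S (f : ℍ → ℂ) (g σ : SL(2, ℤ))
    (hσ : (σ : Matrix (Fin 2) (Fin 2) ℤ) = !![0, -1; 1, 0]) (s : ℝ) (hs : 0 < s) :
    vslash f (g * σ) (Complex.I * s) = -(((s ^ 2)⁻¹ : ℝ) : ℂ) *
      vslash f g (Complex.I * ((s⁻¹ : ℝ) : ℂ)) := by
  have hs' : (s : ℂ) ≠ 0 := by exact_mod_cast hs.ne'
  rw [vslash_mul _ _ _ _ (by rw [im_I_mul]; exact hs)]
  have e : ((((σ 0 0 : ℤ) : ℂ) * (Complex.I * s) + ((σ 0 1 : ℤ) : ℂ)) /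
      (((σ 1 0 : ℤ) : ℂ) * (Complex.I * s) + ((σ 1 1 : ℤ) : ℂ))) =
      Complex.I * ((s⁻¹ : ℝ) : ℂ) := by
    simp [hσ]
    field_simp
    simp
  rw [e]
  simp [hσ, mul_pow]
  field_simp

lemma vslash_cont (N : ℕ) [NeZero N] (f : CuspForm (CongruenceSubgroup.Gamma1 N) 2)
    (g : SL(2, ℤ)) :
    ContinuousOn (fun s : ℝ => vslash f g (Complex.I * s)) (Set.Ioi 0) := by
  intro s hs
  apply ContinuousAt.continuousWithinAt
  have h1 : ContinuousAt (vslash f g) (Complex.I * (s : ℂ)) :=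
    (vslash_diff N f g _ (by rw [im_I_mul]; exact hs)).continuousAt
  exact ContinuousAt.comp (f := fun s : ℝ => Complex.I * (s : ℂ)) h1 (by fun_prop)

lemma vslash_integ (N : ℕ) [NeZero N] (f : CuspForm (CongruenceSubgroup.Gamma1 N) 2)
    (g : SL(2, ℤ)) :
    IntegrableOn (fun s : ℝ => vslash f g (Complex.I * s)) (Set.Ioi 0) := by
  have h : MellinConvergent (fun s : ℝ => vslash f g (Complex.I * s)) 1 := by
    refine mellinConvergent_of_isBigO_rpow (a := 2) (b := 0)
      ((vslash_cont N f g).locallyIntegrableOn measurableSet_Ioi) ?_ (by simp) ?_ (by simp)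
    · obtain ⟨C, A, hC, hA, h⟩ := vslash_decay N f g
      refine Asymptotics.IsBigO.of_bound C ?_
      filter_upwards [eventually_ge_atTop A] with s hs
      have hs0 : 0 < s := hA.trans_le hs
      refine (h (Complex.I * s) (by rwa [im_I_mul])).trans (le_of_eq ?_)
      rw [im_I_mul, Real.norm_of_nonneg (by positivity), Real.rpow_neg hs0.le, div_eq_mul_inv]
      norm_num
    · obtain ⟨C, A, hC, hA, h⟩ := vslash_decay N f (g * ModularGroup.S)
      refine Asymptotics.IsBigO.of_bound C ?_
      have : Set.Ioc 0 A⁻¹ ∈ 𝓝[>] (0 : ℝ) := Ioc_mem_nhdsGT (by positivity)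
      filter_upwards [this] with s hs
      have hs0 : 0 < s := hs.1
      have e := vslash_S f g ModularGroup.S ModularGroup.coe_S s⁻¹ (by positivity)
      have hA' : A ≤ s⁻¹ := (le_inv_comm₀ hA hs0).2 hs.2
      have hb := h (Complex.I * ((s⁻¹ : ℝ) : ℂ)) (by rwa [im_I_mul])
      rw [e, im_I_mul, inv_inv, norm_mul, norm_neg, Complex.norm_real,
        Real.norm_of_nonneg (by positivity)] at hb
      simp only [inv_pow, inv_inv, div_inv_eq_mul] at hb
      have h2 : 0 < s ^ 2 := by positivity
      simp
      nlinarith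
  simpa [MellinConvergent] using h

lemma manin_S (f : ℍ → ℂ) (g σ : SL(2, ℤ))
    (hσ : (σ : Matrix (Fin 2) (Fin 2) ℤ) = !![0, -1; 1, 0]) :
    maninSymbol f (g * σ) = -maninSymbol f g := by
  unfold maninSymbol
  rw [← integral_comp_rpow_Ioi (fun s : ℝ => vslash f g (Complex.I * s)) (p := -1) (by norm_num),
    ← integral_neg]
  refine setIntegral_congr_fun measurableSet_Ioi fun s hs => ?_
  have hs0 : 0 < s := hs
  change vslash f (g * σ) (Complex.I * s) = -((|(-1 : ℝ)| * s ^ ((-1 : ℝ) - 1)) •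
    vslash f g (Complex.I * ((s ^ (-1 : ℝ) : ℝ) : ℂ)))
  rw [vslash_S f g σ hσ s hs0, Real.rpow_neg_one]
  have : |(-1 : ℝ)| * s ^ ((-1 : ℝ) - 1) = (s ^ 2)⁻¹ := by
    rw [show (-1 : ℝ) - 1 = -2 by norm_num, Real.rpow_neg hs0.le]
    norm_num
  rw [this]
  simp

/-- The composite of `G` with the Moebius transformation of `h`. -/
noncomputable def pullG (G : ℂ → ℂ) (h : SL(2, ℤ)) (w : ℂ) : ℂ :=
  G ((((h 0 0 : ℤ) : ℂ) * w + ((h 0 1 : ℤ) : ℂ)) /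
      (((h 1 0 : ℤ) : ℂ) * w + ((h 1 1 : ℤ) : ℂ)))

lemma pullG_deriv (f : ℍ → ℂ) (g h : SL(2, ℤ)) (G : ℂ → ℂ)
    (hG : ∀ w : ℂ, 0 < w.im → HasDerivAt G (vslash f g w) w) (w : ℂ) (hw : 0 < w.im) :
    HasDerivAt (pullG G h) (vslash f (g * h) w) w := by
  have hne := denom_ne h w hw
  have hm : HasDerivAt (fun w : ℂ => (((h 0 0 : ℤ) : ℂ) * w + ((h 0 1 : ℤ) : ℂ)) /
      (((h 1 0 : ℤ) : ℂ) * w + ((h 1 1 : ℤ) : ℂ)))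
      (1 / (((h 1 0 : ℤ) : ℂ) * w + ((h 1 1 : ℤ) : ℂ)) ^ 2) w := by
    have := (((hasDerivAt_id w).const_mul ((h 0 0 : ℤ) : ℂ)).add_const ((h 0 1 : ℤ) : ℂ)).div
      (((hasDerivAt_id w).const_mul ((h 1 0 : ℤ) : ℂ)).add_const ((h 1 1 : ℤ) : ℂ)) hne
    refine this.congr_deriv ?_
    have d := congrArg (Int.cast : ℤ → ℂ) h.det_coe
    rw [Matrix.det_fin_two] at d
    push_cast at d
    congr 1
    simp only [id]
    linear_combination d
  have := (hG _ (moeb_im h w hw)).comp w hm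
  refine this.congr_deriv ?_
  rw [vslash_mul _ _ _ _ hw]
  ring

lemma horiz (N : ℕ) [NeZero N] (f : CuspForm (CongruenceSubgroup.Gamma1 N) 2)
    (g : SL(2, ℤ)) (P : ℂ → ℂ) (hP : ∀ w : ℂ, 0 < w.im → HasDerivAt P (vslash f g w) w) :
    Tendsto (fun T : ℝ => P (Complex.I * T) - P (1 + Complex.I * T)) atTop (𝓝 0) := by
  obtain ⟨C, A, hC, hA, h⟩ := vslash_decay N f g
  have hlim : Tendsto (fun T : ℝ => C / T ^ 2) atTop (𝓝 0) :=
    tendsto_const_nhds.div_atTop (tendsto_pow_atTop two_ne_zero)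
  refine squeeze_zero_norm' ?_ hlim
  filter_upwards [eventually_ge_atTop A] with T hT
  have hT0 : 0 < T := hA.trans_le hT
  have hconv : Convex ℝ {w : ℂ | w.im = T} := by
    have : {w : ℂ | w.im = T} = Complex.imCLM ⁻¹' {T} := by ext; simp
    rw [this]
    exact (convex_singleton T).linear_preimage Complex.imCLM.toLinearMap
  have := hconv.norm_image_sub_le_of_norm_hasDerivWithin_le (f := P) (f' := vslash f g)
    (C := C / T ^ 2) (x := 1 + Complex.I * T) (y := Complex.I * T)
    (fun w hw => (hP w (by rw [show w.im = T from hw]; exact hT0)).hasDerivWithinAt)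
    (fun w hw => by
      have := h w (by rw [show w.im = T from hw]; exact hT)
      rwa [show w.im = T from hw] at this) (by simp) (by simp)
  simpa using this

lemma trunc (N : ℕ) [NeZero N] (f : CuspForm (CongruenceSubgroup.Gamma1 N) 2)
    (g : SL(2, ℤ)) (P : ℂ → ℂ) (hP : ∀ w : ℂ, 0 < w.im → HasDerivAt P (vslash f g w) w) :
    Tendsto (fun T : ℝ => -Complex.I * (P (Complex.I * T) - P (Complex.I * ((T⁻¹ : ℝ) : ℂ))))
      atTop (𝓝 (maninSymbol f g)) := by
  have hcov : AECover (volume.restrict (Set.Ioi (0 : ℝ))) atTop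
      (fun T : ℝ => Set.Ioc T⁻¹ T) := by
    have h1 : AECover (volume.restrict (Set.Ioi (0 : ℝ))) atTop (fun T : ℝ => Set.Ioi T⁻¹) :=
      aecover_Ioi_of_Ioi tendsto_inv_atTop_zero
    have h2 : AECover (volume.restrict (Set.Ioi (0 : ℝ))) atTop (fun T : ℝ => Set.Iic T) :=
      (aecover_Iic tendsto_id).mono Measure.restrict_le_self
    exact h1.inter h2
  have ht := hcov.integral_tendsto_of_countably_generated (vslash_integ N f g)
  refine ht.congr' ?_
  filter_upwards [eventually_ge_atTop 1] with T hT
  have hT0 : 0 < T := by linarith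
  have hle : T⁻¹ ≤ T := (inv_le_one_of_one_le₀ hT).trans hT
  have hsub : Set.Ioc T⁻¹ T ⊆ Set.Ioi (0 : ℝ) := fun x hx => lt_trans (by positivity) hx.1
  rw [Measure.restrict_restrict measurableSet_Ioc, Set.inter_eq_left.2 hsub,
    ← intervalIntegral.integral_of_le hle]
  have hsub' : Set.uIcc T⁻¹ T ⊆ Set.Ioi (0 : ℝ) := fun x hx => by
    rw [Set.uIcc_of_le hle] at hx
    exact lt_of_lt_of_le (by positivity) hx.1
  have hder : ∀ s ∈ Set.uIcc T⁻¹ T, HasDerivAt (fun s : ℝ => -Complex.I * P (Complex.I * s))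
      (vslash f g (Complex.I * s)) s := by
    intro s hs
    have h0 : 0 < s := hsub' hs
    have h1 : HasDerivAt (fun s : ℝ => Complex.I * (s : ℂ)) Complex.I s := by
      simpa using (Complex.ofRealCLM.hasDerivAt (x := s)).const_mul Complex.I
    have h2 := ((hP (Complex.I * s) (by rw [im_I_mul]; exact h0)).comp s h1).const_mul (-Complex.I)
    refine h2.congr_deriv ?_
    linear_combination (-vslash f g (Complex.I * s)) * Complex.I_mul_I
  rw [intervalIntegral.integral_eq_sub_of_hasDerivAt hder
    ((vslash_cont N f g).mono hsub').intervalIntegrable]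
  ring

lemma manin_T (N : ℕ) [NeZero N] (f : CuspForm (CongruenceSubgroup.Gamma1 N) 2)
    (g τ : SL(2, ℤ)) (hτ : (τ : Matrix (Fin 2) (Fin 2) ℤ) = !![0, -1; 1, -1]) :
    maninSymbol f g + maninSymbol f (g * τ) + maninSymbol f (g * τ * τ) = 0 := by
  obtain ⟨G, hG⟩ := exists_prim (vslash f g) (vslash_diff N f g)
  have hG1 := pullG_deriv f g τ G hG
  have hG2 := pullG_deriv f g (τ * τ) G hG
  rw [← mul_assoc] at hG2
  have t := ((trunc N f g G hG).add (trunc N f _ _ hG1)).add (trunc N f _ _ hG2)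
  have d := (((horiz N f g G hG).add (horiz N f _ _ hG1)).add
    (horiz N f _ _ hG2)).const_mul (-Complex.I)
  simp only [add_zero, mul_zero] at d
  refine tendsto_nhds_unique t (d.congr' ?_)
  filter_upwards [eventually_gt_atTop 0] with T hT
  have hT' : (T : ℂ) ≠ 0 := by exact_mod_cast hT.ne'
  have hττ : ((τ * τ : SL(2, ℤ)) : Matrix (Fin 2) (Fin 2) ℤ) = !![-1, 1; -1, 0] := by
    rw [Matrix.SpecialLinearGroup.coe_mul, hτ]
    ext i j; fin_cases i <;> fin_cases j <;> simp
  have n1 : 1 + Complex.I * (T : ℂ) ≠ 0 := by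
    intro h; have := congrArg Complex.re h; simp at this
  have n2 : Complex.I * (T : ℂ)⁻¹ - 1 ≠ 0 := by
    intro h; have := congrArg Complex.re h; simp [← Complex.ofReal_inv] at this
  have e0 : pullG G τ (1 + Complex.I * T) = G (Complex.I * ((T⁻¹ : ℝ) : ℂ)) := by
    simp only [pullG, hτ]
    congr 1
    simp
    field_simp
    simp
  have e1 : pullG G (τ * τ) (1 + Complex.I * T) = pullG G τ (Complex.I * ((T⁻¹ : ℝ) : ℂ)) := by
    simp only [pullG, hτ, hττ]
    congr 1
    simp
    have n3 : -(Complex.I * (T : ℂ)) + -1 ≠ 0 := by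
      intro h; apply n1; linear_combination -h
    have n4 : Complex.I * (T : ℂ)⁻¹ + -1 ≠ 0 := by simpa [sub_eq_add_neg] using n2
    rw [div_eq_div_iff n3 n4]
    field_simp
    linear_combination (-1 : ℂ) * Complex.I_mul_I
  have e2 : G (1 + Complex.I * T) = pullG G (τ * τ) (Complex.I * ((T⁻¹ : ℝ) : ℂ)) := by
    simp only [pullG, hττ]
    congr 1
    simp
    field_simp
    linear_combination (T : ℂ) * Complex.I_mul_I
  rw [e0, e1, e2]
  ring

end Aux

/-- Manin relations: if `f` is a cusp form of weight 2 on `Γ₁(N)` and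
`g, gσ, gτ, gτ²` are matrices in `SL₂(ℤ)` whose bottom rows are congruent
mod `N` to `x, xσ, xτ, xτ²` respectively (where `x` is the bottom row of `g`,
`σ = [[0,-1],[1,0]]`, `τ = [[0,-1],[1,-1]]`), then
`ξ_f(xσ) = -ξ_f(x)` and `ξ_f(x) + ξ_f(xτ) + ξ_f(xτ²) = 0`. -/
theorem stmt_10 (N : ℕ) [NeZero N]
    (f : CuspForm (CongruenceSubgroup.Gamma1 N) 2)
    (σ τ : SL(2, ℤ))
    (hσ : (σ : Matrix (Fin 2) (Fin 2) ℤ) = !![0, -1; 1, 0])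
    (hτ : (τ : Matrix (Fin 2) (Fin 2) ℤ) = !![0, -1; 1, -1])
    (g gs gt gt2 : SL(2, ℤ))
    (hgs : ∀ j : Fin 2, ((gs : Matrix (Fin 2) (Fin 2) ℤ) 1 j : ZMod N) =
      (((g * σ) : Matrix (Fin 2) (Fin 2) ℤ) 1 j : ZMod N))
    (hgt : ∀ j : Fin 2, ((gt : Matrix (Fin 2) (Fin 2) ℤ) 1 j : ZMod N) =
      (((g * τ) : Matrix (Fin 2) (Fin 2) ℤ) 1 j : ZMod N))
    (hgt2 : ∀ j : Fin 2, ((gt2 : Matrix (Fin 2) (Fin 2) ℤ) 1 j : ZMod N) =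
      (((g * τ * τ) : Matrix (Fin 2) (Fin 2) ℤ) 1 j : ZMod N)) :
    maninSymbol f gs = -maninSymbol f g ∧
      maninSymbol f g + maninSymbol f gt + maninSymbol f gt2 = 0 := by

  have hs := vslash_congr N f (g * σ) gs (by simpa using hgs)
  have ht := vslash_congr N f (g * τ) gt (by simpa using hgt)
  have ht2 := vslash_congr N f (g * τ * τ) gt2 (by simpa using hgt2)
  have es : maninSymbol f gs = maninSymbol f (g * σ) := by simp only [maninSymbol, hs]
  have et : maninSymbol f gt = maninSymbol f (g * τ) := by simp only [maninSymbol, ht]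
  have et2 : maninSymbol f gt2 = maninSymbol f (g * τ * τ) := by simp only [maninSymbol, ht2]
  rw [es, et, et2]
  exact ⟨manin_S f g σ hσ, manin_T N f g τ hτ⟩
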